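/- Assume P[y²] < ∞. Define T̄(z) = ∫_𝒜 (P[y 1_A(x)] / P(A)) 1_A(z) ν(dA), with the convention 0/0 = 0. Then for every z ∈ [0,1]^p with k(z,z) < ∞, the integral ∫_{[0,1]^p × ℝ} y k(x,z) P(dx, dy) is absolutely convergent and equals T̄(z). -/

import Mathlib

open MeasureTheory
open scoped ENNReal RealInnerProductSpace

noncomputable section

/-- Points of the unit cube `[0,1]^p`. -/
abbrev Pt (p : ℕ) : Type := Fin p → Set.Icc (0 : ℝ) 1

/-- Hyperrectangles `∏_j [a_j, b_j⟩` of `[0,1]^p`, encoded by the pair of endpoints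
`(a, b)` with `0 ≤ a_j < b_j ≤ 1`, viewed as a subtype of `(Fin p → ℝ) × (Fin p → ℝ)`
with the inherited sup metric (which is exactly the metric `ρ`) and its Borel σ-algebra. -/
abbrev HRect (p : ℕ) : Type :=
  {ab : (Fin p → ℝ) × (Fin p → ℝ) // ∀ j, 0 ≤ ab.1 j ∧ ab.1 j < ab.2 j ∧ ab.2 j ≤ 1}

/-- Membership `z ∈ [a, b⟩`: `a_j ≤ z_j` and (`z_j < b_j`, or `b_j = 1` in which case
`z_j ≤ b_j` holds automatically). -/
def memRect {p : ℕ} (z : Pt p) (A : HRect p) : Prop :=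
  ∀ j, A.1.1 j ≤ (z j : ℝ) ∧ ((z j : ℝ) < A.1.2 j ∨ A.1.2 j = 1)

/-- The indicator `1_A(z)`. -/
def ind {p : ℕ} (z : Pt p) (A : HRect p) : ℝ :=
  haveI := Classical.propDecidable (memRect z A)
  if memRect z A then 1 else 0

/-- The kernel `k0(z,z') = ∫ 1_A(z) 1_A(z') ν(dA)`. -/
def k0 {p : ℕ} (ν : Measure (HRect p)) (z z' : Pt p) : ℝ :=
  ∫ A, ind z A * ind z' A ∂ν

/-- `P(A)`: the measure of the hyperrectangle `A` under the first marginal of `P`. -/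
def PA {p : ℕ} (P : Measure (Pt p × ℝ)) (A : HRect p) : ℝ :=
  (P.fst {z | memRect z A}).toReal

/-- `α_P²(A) = 1/P(A)` if `P(A) > 0`, and `1` otherwise. -/
def alphaSq {p : ℕ} (P : Measure (Pt p × ℝ)) (A : HRect p) : ℝ :=
  haveI := Classical.propDecidable (0 < PA P A)
  if 0 < PA P A then 1 / PA P A else 1

/-- The kernel `k(z,z') = ∫ α_P²(A) 1_A(z) 1_A(z') ν(dA) ∈ [0,∞]`. -/
def kk {p : ℕ} (P : Measure (Pt p × ℝ)) (ν : Measure (HRect p)) (z z' : Pt p) : ℝ≥0∞ :=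
  ∫⁻ A, ENNReal.ofReal (alphaSq P A * ind z A * ind z' A) ∂ν


/-- `P[y 1_A(x)]`. -/
def numer {p : ℕ} (P : Measure (Pt p × ℝ)) (A : HRect p) : ℝ :=
  ∫ w : Pt p × ℝ, w.2 * ind w.1 A ∂P

/-- The infinite random forest `T̄(z) = ∫ (P[y 1_A(x)] / P(A)) 1_A(z) ν(dA)`
(with the convention `0/0 = 0`, which is Lean's division by zero). -/
def Tbar {p : ℕ} (P : Measure (Pt p × ℝ)) (ν : Measure (HRect p)) (z : Pt p) : ℝ :=
  ∫ A, (numer P A / PA P A) * ind z A ∂ν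

lemma ind_eq_indicator {p : ℕ} (z : Pt p) (A : HRect p) :
    ind z A = {q : Pt p × HRect p | memRect q.1 q.2}.indicator (fun _ => (1 : ℝ)) (z, A) := by
  classical
  simp [ind, Set.indicator_apply]

lemma ind_nonneg {p : ℕ} (z : Pt p) (A : HRect p) : 0 ≤ ind z A := by
  unfold ind; split_ifs <;> norm_num

lemma ind_le_one {p : ℕ} (z : Pt p) (A : HRect p) : ind z A ≤ 1 := by
  unfold ind; split_ifs <;> norm_num

lemma ind_mul_self {p : ℕ} (z : Pt p) (A : HRect p) : ind z A * ind z A = ind z A := by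
  unfold ind; split_ifs <;> norm_num

lemma measurableSet_memRect {p : ℕ} :
    MeasurableSet {q : Pt p × HRect p | memRect q.1 q.2} := by
  have key : ∀ j : Fin p, MeasurableSet {q : Pt p × HRect p |
      q.2.1.1 j ≤ (q.1 j : ℝ) ∧ ((q.1 j : ℝ) < q.2.1.2 j ∨ q.2.1.2 j = 1)} := by
    intro j
    have hz : Measurable fun q : Pt p × HRect p => (q.1 j : ℝ) :=
      measurable_subtype_coe.comp ((measurable_pi_apply j).comp measurable_fst)
    have ha : Measurable fun q : Pt p × HRect p => q.2.1.1 j :=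
      (measurable_pi_apply j).comp
        (measurable_fst.comp (measurable_subtype_coe.comp measurable_snd))
    have hb : Measurable fun q : Pt p × HRect p => q.2.1.2 j :=
      (measurable_pi_apply j).comp
        (measurable_snd.comp (measurable_subtype_coe.comp measurable_snd))
    exact (measurableSet_le ha hz).inter
      ((measurableSet_lt hz hb).union (measurableSet_eq_fun hb measurable_const))
  simpa only [memRect, Set.ofPred_forall] using MeasurableSet.iInter key

lemma measurable_ind {p : ℕ} : Measurable fun q : Pt p × HRect p => ind q.1 q.2 := by
  simp only [ind_eq_indicator]
  exact measurable_const.indicator measurableSet_memRect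

lemma measurable_ind_right {p : ℕ} (z : Pt p) : Measurable fun A : HRect p => ind z A :=
  measurable_ind.comp measurable_prodMk_left

lemma measurable_PA {p : ℕ} (P : Measure (Pt p × ℝ)) [IsProbabilityMeasure P] :
    Measurable (PA P) :=
  (measurable_measure_prodMk_right measurableSet_memRect).ennreal_toReal

lemma measurable_alphaSq {p : ℕ} (P : Measure (Pt p × ℝ)) [IsProbabilityMeasure P] :
    Measurable (alphaSq P) := by
  unfold alphaSq
  exact Measurable.ite (measurableSet_lt measurable_const (measurable_PA P))
    ((measurable_PA P).const_div 1) measurable_const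

lemma alphaSq_nonneg {p : ℕ} (P : Measure (Pt p × ℝ)) (A : HRect p) : 0 ≤ alphaSq P A := by
  unfold alphaSq
  split_ifs with h
  · positivity
  · exact zero_le_one

lemma numer_eq_zero_of_PA_eq_zero {p : ℕ} {P : Measure (Pt p × ℝ)} [IsProbabilityMeasure P]
    {A : HRect p} (h : PA P A = 0) : numer P A = 0 := by
  have h0 : P.fst {x | memRect x A} = 0 :=
    ((ENNReal.toReal_eq_zero_iff _).1 h).resolve_right (measure_ne_top _ _)
  have hae : ∀ᵐ w ∂P, ¬ memRect w.1 A := by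
    have hA : MeasurableSet {x : Pt p | memRect x A} :=
      measurable_prodMk_right measurableSet_memRect
    rw [Measure.fst_apply hA] at h0
    simpa [ae_iff] using h0
  refine integral_eq_zero_of_ae ?_
  filter_upwards [hae] with w hw
  simp [ind, hw]

lemma alphaSq_mul_numer {p : ℕ} (P : Measure (Pt p × ℝ)) [IsProbabilityMeasure P]
    (A : HRect p) : alphaSq P A * numer P A = numer P A / PA P A := by
  by_cases h : 0 < PA P A
  · simp [alphaSq, h, div_eq_inv_mul]
  · have h0 : PA P A = 0 := le_antisymm (not_lt.1 h) ENNReal.toReal_nonneg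
    simp [numer_eq_zero_of_PA_eq_zero h0]

lemma toReal_kk {p : ℕ} (P : Measure (Pt p × ℝ)) [IsProbabilityMeasure P]
    (ν : Measure (HRect p)) (x z : Pt p) :
    (kk P ν x z).toReal = ∫ A, alphaSq P A * ind x A * ind z A ∂ν := by
  refine (integral_eq_lintegral_of_nonneg_ae (.of_forall fun A => ?_) ?_).symm
  · exact mul_nonneg (mul_nonneg (alphaSq_nonneg P A) (ind_nonneg x A)) (ind_nonneg z A)
  · exact (((measurable_alphaSq P).mul (measurable_ind_right x)).mul
      (measurable_ind_right z)).aestronglyMeasurable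

lemma integrable_alphaSq_mul_ind {p : ℕ} {P : Measure (Pt p × ℝ)} [IsProbabilityMeasure P]
    {ν : Measure (HRect p)} {z : Pt p} (hz : kk P ν z z < ⊤) :
    Integrable (fun A => alphaSq P A * ind z A) ν := by
  refine ⟨((measurable_alphaSq P).mul (measurable_ind_right z)).aestronglyMeasurable, ?_⟩
  rw [hasFiniteIntegral_iff_ofReal
    (.of_forall fun A => mul_nonneg (alphaSq_nonneg P A) (ind_nonneg z A))]
  simpa only [kk, mul_assoc, ind_mul_self] using hz

lemma integrable_prod_kernel {p : ℕ} {P : Measure (Pt p × ℝ)} [IsProbabilityMeasure P]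
    {ν : Measure (HRect p)} [IsFiniteMeasure ν]
    (hy : Integrable (fun w : Pt p × ℝ => w.2) P) {z : Pt p} (hz : kk P ν z z < ⊤) :
    Integrable (fun q : (Pt p × ℝ) × HRect p =>
      q.1.2 * (alphaSq P q.2 * ind q.1.1 q.2 * ind z q.2)) (P.prod ν) := by
  have hind : Measurable fun q : (Pt p × ℝ) × HRect p => ind q.1.1 q.2 :=
    measurable_ind.comp ((measurable_fst.comp measurable_fst).prodMk measurable_snd)
  have h := (hy.mul_prod (integrable_alphaSq_mul_ind hz)).mul_bdd
    (c := 1) hind.aestronglyMeasurable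
    (.of_forall fun q => by
      simpa [abs_of_nonneg (ind_nonneg q.1.1 q.2)] using ind_le_one q.1.1 q.2)
  refine h.congr (.of_forall fun q => ?_)
  dsimp only
  ring

/-- if `P[y²] < ∞`, then for every `z` with `k(z,z) < ∞` the integral
`∫ y k(x,z) P(dx,dy)` is absolutely convergent and equals `T̄(z)`. -/
theorem stmt6 {p : ℕ} (ν : Measure (HRect p)) [IsFiniteMeasure ν]
    (hnorm : ∀ z : Pt p, ∫ A, ind z A ∂ν = 1)
    (P : Measure (Pt p × ℝ)) [IsProbabilityMeasure P]
    (hy2 : Integrable (fun w : Pt p × ℝ => w.2 ^ 2) P)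
    (z : Pt p) (hz : kk P ν z z < ⊤) :
    Integrable (fun w : Pt p × ℝ => w.2 * (kk P ν w.1 z).toReal) P ∧
    (∫ w : Pt p × ℝ, w.2 * (kk P ν w.1 z).toReal ∂P) = Tbar P ν z := by
  have hy : Integrable (fun w : Pt p × ℝ => w.2) P :=
    ((memLp_two_iff_integrable_sq measurable_snd.aestronglyMeasurable).2 hy2).integrable
      one_le_two
  have hF := integrable_prod_kernel hy hz
  simp only [toReal_kk, ← integral_const_mul]
  refine ⟨hF.integral_prod_left, (integral_integral_swap hF).trans ?_⟩
  refine integral_congr_ae (.of_forall fun A => ?_)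
  dsimp only
  rw [← alphaSq_mul_numer, numer, ← integral_const_mul, ← integral_mul_const]
  congr 1
  ext w
  ring

end
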